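/- arXiv:2207.03652 — 3 statements merged into one kernel-verified Lean document; each statement's English description precedes it below -/
import Mathlib

section
/- Let X be an n×d real matrix with rows x_1,…,x_n and Y an n×m real matrix with rows y_1,…,y_n. Let E_X and E_Y be their n×n squared Euclidean distance matrices, J = I − (1/n)eeᵀ the centering matrix, W(X) = J E_X J, and L^W(X) = D(W(X)) − W(X) the graph Laplacian of the adjacency matrix W(X). Then (1/n²) ∑_{i,j=1}^n [J E_X J]_{ij} [J E_Y J]_{ij} = (2/n²) Tr(Yᵀ L^W(X) Y). -/
open Matrix BigOperators

/-- With `E_X, E_Y` the squared distance matrices, `J` the centering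
matrix, `W(X) = J E_X J` and `L^W(X) = D(W(X)) - W(X)` its graph Laplacian,
`(1/n²) ∑_{i,j} [J E_X J]_{ij} [J E_Y J]_{ij} = (2/n²) Tr(Yᵀ L^W(X) Y)`. -/
theorem dcov_eq_trace_laplacian
    (n d m : ℕ) (x : Fin n → EuclideanSpace ℝ (Fin d)) (y : Fin n → EuclideanSpace ℝ (Fin m))
    (Y : Matrix (Fin n) (Fin m) ℝ) (hY : Y = Matrix.of fun i a => y i a)
    (EX EY : Matrix (Fin n) (Fin n) ℝ)
    (hEX : EX = Matrix.of fun i j => ‖x i - x j‖ ^ 2)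
    (hEY : EY = Matrix.of fun i j => ‖y i - y j‖ ^ 2)
    (J : Matrix (Fin n) (Fin n) ℝ)
    (hJ : J = (1 : Matrix (Fin n) (Fin n) ℝ) - ((n : ℝ))⁻¹ • Matrix.of (fun _ _ => (1 : ℝ)))
    (W : Matrix (Fin n) (Fin n) ℝ) (hW : W = J * EX * J)
    (LW : Matrix (Fin n) (Fin n) ℝ)
    (hLW : LW = Matrix.diagonal (fun i => ∑ j, W i j) - W) :
    (1 / (n : ℝ) ^ 2) * ∑ i, ∑ j, (J * EX * J) i j * (J * EY * J) i j =
      (2 / (n : ℝ) ^ 2) * Matrix.trace (Yᵀ * LW * Y) := by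
  rcases Nat.eq_zero_or_pos n with h0 | hn
  · subst h0
    simp
  have hn' : (n : ℝ) ≠ 0 := by positivity
  -- the all-ones matrix and basic facts on the centering matrix
  have hJT : Jᵀ = J := by
    subst hJ
    ext i j
    simp [Matrix.one_apply, eq_comm]
  have hrow : ∀ i, ∑ j, J i j = 0 := by
    intro i
    subst hJ
    simp [Matrix.one_apply, Finset.sum_sub_distrib, hn']
  have hcol : ∀ j, ∑ i, J i j = 0 := by
    intro j
    rw [← hrow j]
    refine Finset.sum_congr rfl fun i _ => ?_
    conv_lhs => rw [← hJT]
    rfl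
  have hJO : J * Matrix.of (fun _ _ => (1 : ℝ)) = (0 : Matrix (Fin n) (Fin n) ℝ) := by
    ext i j
    simp [Matrix.mul_apply, hrow]
  have hJJ : J * J = J := by
    conv_lhs => rw [hJ]
    rw [Matrix.mul_sub, Matrix.mul_smul, ← hJ, hJO]
    simp
  have hW1 : ∀ i, ∑ j, W i j = 0 := by
    intro i
    rw [hW]
    simp only [Matrix.mul_apply (M := J * EX)]
    rw [Finset.sum_comm]
    simp [← Finset.mul_sum, hrow]
  have hL : LW = -W := by
    rw [hLW]
    simp [hW1]
  have hJW : J * W = W := by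
    rw [hW, ← Matrix.mul_assoc, ← Matrix.mul_assoc, hJJ]
  have hWJ : W * J = W := by
    rw [hW, Matrix.mul_assoc, hJJ]
  have hE : EY = Matrix.of (fun i _ => ‖y i‖ ^ 2) + Matrix.of (fun _ j => ‖y j‖ ^ 2)
      - (2 : ℝ) • (Y * Yᵀ) := by
    subst hEY hY
    ext i j
    simp only [Matrix.of_apply, Matrix.sub_apply, Matrix.add_apply, Matrix.smul_apply,
      Matrix.mul_apply, Matrix.transpose_apply, smul_eq_mul]
    rw [@norm_sub_sq_real, PiLp.inner_apply]
    simp only [RCLike.inner_apply, conj_trivial]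
    simp only [mul_comm (y j _)]
    ring
  have h1 : Matrix.of (fun (i : Fin n) (_ : Fin n) => ‖y i‖ ^ 2) * J = 0 := by
    ext i j
    simp [Matrix.mul_apply, ← Finset.mul_sum, hcol]
  have h2 : J * Matrix.of (fun (_ : Fin n) (j : Fin n) => ‖y j‖ ^ 2) = 0 := by
    ext i j
    simp [Matrix.mul_apply, ← Finset.sum_mul, hrow]
  have hB : J * EY * J = (-2 : ℝ) • (J * (Y * Yᵀ) * J) := by
    rw [hE, Matrix.mul_sub, Matrix.mul_add, h2, add_zero, Matrix.sub_mul,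
      Matrix.mul_assoc J _ J, h1]
    simp
  have hBT : (J * EY * J)ᵀ = (-2 : ℝ) • (J * (Y * Yᵀ) * J) := by
    rw [hB]
    simp [Matrix.transpose_mul, hJT, Matrix.mul_assoc]
  have hsum : ∑ i, ∑ j, (J * EX * J) i j * (J * EY * J) i j
      = Matrix.trace (W * (J * EY * J)ᵀ) := by
    rw [hW]
    simp only [Matrix.trace, Matrix.diag_apply, Matrix.mul_apply (M := J * EX * J),
      Matrix.transpose_apply]
  have htr : Matrix.trace (W * (J * (Y * Yᵀ) * J)) = Matrix.trace (Yᵀ * W * Y) := by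
    rw [← Matrix.mul_assoc, Matrix.trace_mul_comm, ← Matrix.mul_assoc, ← Matrix.mul_assoc, hJW,
      hWJ, ← Matrix.mul_assoc, Matrix.trace_mul_comm, ← Matrix.mul_assoc]
  rw [hsum, hBT, Matrix.mul_smul, Matrix.trace_smul, htr, hL]
  simp only [Matrix.mul_neg, Matrix.neg_mul, Matrix.trace_neg, smul_eq_mul]
  ring
end

section
/- Let X be an n×d real matrix with rows x_1,…,x_n and Y an n×m real matrix with rows y_1,…,y_n, with squared Euclidean distance matrices E_X and E_Y. With J = I − (1/n)eeᵀ, W(X) = J E_X J, W(Y) = J E_Y J, and L^W(·) denoting the graph Laplacian D(W) − W, one has Tr(Yᵀ L^W(X) Y) = Tr(Xᵀ L^W(Y) X). -/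
open Matrix BigOperators

theorem lap_aux (n d : ℕ) (x : Fin n → EuclideanSpace ℝ (Fin d))
    (X : Matrix (Fin n) (Fin d) ℝ) (hX : X = Matrix.of fun i a => x i a)
    (EX : Matrix (Fin n) (Fin n) ℝ)
    (hEX : EX = Matrix.of fun i j => ‖x i - x j‖ ^ 2)
    (J : Matrix (Fin n) (Fin n) ℝ)
    (h1 : J *ᵥ 1 = 0) (h2 : 1 ᵥ* J = 0)
    (WX : Matrix (Fin n) (Fin n) ℝ) (hWX : WX = J * EX * J)
    (LWX : Matrix (Fin n) (Fin n) ℝ)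
    (hLWX : LWX = Matrix.diagonal (fun i => ∑ j, WX i j) - WX) :
    LWX = (2 : ℝ) • (J * (X * Xᵀ) * J) := by
  have hE : EX = vecMulVec (fun i => ‖x i‖ ^ 2) 1 + vecMulVec 1 (fun i => ‖x i‖ ^ 2)
      - (2 : ℝ) • (X * Xᵀ) := by
    subst hEX hX
    ext i j
    have := norm_sub_sq_real (x i) (x j)
    simp only [PiLp.inner_apply, RCLike.inner_apply, conj_trivial] at this
    simp [vecMulVec_apply, Matrix.mul_apply, this, mul_comm]
    ring
  have hs : ∀ i, ∑ j, WX i j = 0 := by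
    intro i
    have h : WX *ᵥ 1 = 0 := by
      rw [hWX, ← Matrix.mulVec_mulVec, h1, Matrix.mulVec_zero]
    have := congrFun h i
    simpa [Matrix.mulVec, dotProduct] using this
  have hd : Matrix.diagonal (fun i => ∑ j, WX i j) = 0 := by
    simp [hs]
  rw [hLWX, hd, hWX, hE]
  simp only [Matrix.mul_sub, Matrix.mul_add, Matrix.sub_mul, Matrix.add_mul,
    Matrix.mul_vecMulVec, Matrix.vecMulVec_mul, h1, h2, Matrix.vecMulVec_zero,
    Matrix.zero_vecMulVec, Matrix.mul_smul, Matrix.smul_mul]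
  simp

/-- With `W(X) = J E_X J`, `W(Y) = J E_Y J` and `L^W(·)` the graph
Laplacian `D(W) - W`, one has `Tr(Yᵀ L^W(X) Y) = Tr(Xᵀ L^W(Y) X)`. -/
theorem trace_laplacian_symm
    (n d m : ℕ) (x : Fin n → EuclideanSpace ℝ (Fin d)) (y : Fin n → EuclideanSpace ℝ (Fin m))
    (X : Matrix (Fin n) (Fin d) ℝ) (hX : X = Matrix.of fun i a => x i a)
    (Y : Matrix (Fin n) (Fin m) ℝ) (hY : Y = Matrix.of fun i a => y i a)
    (EX EY : Matrix (Fin n) (Fin n) ℝ)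
    (hEX : EX = Matrix.of fun i j => ‖x i - x j‖ ^ 2)
    (hEY : EY = Matrix.of fun i j => ‖y i - y j‖ ^ 2)
    (J : Matrix (Fin n) (Fin n) ℝ)
    (hJ : J = (1 : Matrix (Fin n) (Fin n) ℝ) - ((n : ℝ))⁻¹ • Matrix.of (fun _ _ => (1 : ℝ)))
    (WX WY : Matrix (Fin n) (Fin n) ℝ) (hWX : WX = J * EX * J) (hWY : WY = J * EY * J)
    (LWX LWY : Matrix (Fin n) (Fin n) ℝ)
    (hLWX : LWX = Matrix.diagonal (fun i => ∑ j, WX i j) - WX)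
    (hLWY : LWY = Matrix.diagonal (fun i => ∑ j, WY i j) - WY) :
    Matrix.trace (Yᵀ * LWX * Y) = Matrix.trace (Xᵀ * LWY * X) := by
  have h1 : J *ᵥ 1 = 0 := by
    ext i
    have hn : (n : ℝ) ≠ 0 := by
      have := i.pos
      positivity
    subst hJ
    rw [Matrix.sub_mulVec, Matrix.smul_mulVec]
    simp [Matrix.mulVec, dotProduct, hn]
  have ht : Jᵀ = J := by
    subst hJ
    ext i j
    simp [Matrix.one_apply, eq_comm]
  have h2 : 1 ᵥ* J = 0 := by
    rw [← ht, Matrix.vecMul_transpose, h1]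
  rw [lap_aux n d x X hX EX hEX J h1 h2 WX hWX LWX hLWX,
    lap_aux n m y Y hY EY hEY J h1 h2 WY hWY LWY hLWY]
  simp only [Matrix.mul_smul, Matrix.smul_mul, Matrix.trace_smul]
  congr 1
  have e1 : Yᵀ * (J * (X * Xᵀ) * J) * Y = (Yᵀ * J * X) * (Xᵀ * J * Y) := by
    simp only [Matrix.mul_assoc]
  have e2 : Xᵀ * (J * (Y * Yᵀ) * J) * X = (Xᵀ * J * Y) * (Yᵀ * J * X) := by
    simp only [Matrix.mul_assoc]
  rw [e1, e2, Matrix.trace_mul_comm]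
end

section
/- Let Ω̂², Ŝ, η, τ be real numbers and m, n positive integers with 0 < η < 1, τ > 0, 0 ≤ Ω̂² ≤ Ŝ, and Ŝ > nτ/(1−η). Then (mτ(1+η)Ŝ + nτ(1−η)Ω̂²)/((1+η)Ŝ((1+η)Ŝ + nτ)) ≤ (1−η)(m(1+η) + n(1−η))/(2n(1+η)). -/
/-- If `0 < η < 1`, `τ > 0`, `0 ≤ Ω̂² ≤ Ŝ` and `Ŝ > nτ/(1-η)`, then
`(mτ(1+η)Ŝ + nτ(1-η)Ω̂²)/((1+η)Ŝ((1+η)Ŝ + nτ)) ≤ (1-η)(m(1+η) + n(1-η))/(2n(1+η))`. -/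
theorem lower_bound_additive_error_bound
    (Ωhat2 Shat η τ : ℝ) (m n : ℕ) (hm : 0 < m) (hn : 0 < n)
    (hη0 : 0 < η) (hη1 : η < 1) (hτ : 0 < τ)
    (hΩ0 : 0 ≤ Ωhat2) (hΩS : Ωhat2 ≤ Shat)
    (hS : Shat > n * τ / (1 - η)) :
    (m * τ * (1 + η) * Shat + n * τ * (1 - η) * Ωhat2) /
        ((1 + η) * Shat * ((1 + η) * Shat + n * τ)) ≤
      (1 - η) * (m * (1 + η) + n * (1 - η)) / (2 * n * (1 + η)) := by
  have hn' : (0 : ℝ) < n := by exact_mod_cast hn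
  have hm' : (0 : ℝ) < m := by exact_mod_cast hm
  have h1 : 0 < 1 - η := by linarith
  have hS' : n * τ < Shat * (1 - η) := (div_lt_iff₀ h1).1 hS
  have hSpos : 0 < Shat := lt_trans (by positivity) hS
  have hK : 0 < m * (1 + η) + n * (1 - η) := by positivity
  have hN : m * τ * (1 + η) * Shat + n * τ * (1 - η) * Ωhat2 ≤
      τ * Shat * (m * (1 + η) + n * (1 - η)) := by
    have := mul_le_mul_of_nonneg_left hΩS (show 0 ≤ n * τ * (1 - η) by positivity)
    linarith
  have hD : 2 * n * τ ≤ (1 - η) * ((1 + η) * Shat + n * τ) := by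
    have := mul_le_mul_of_nonneg_left hS'.le (show 0 ≤ 1 + η by positivity)
    linarith
  rw [div_le_div_iff₀ (by positivity) (by positivity)]
  calc _ ≤ τ * Shat * (m * (1 + η) + n * (1 - η)) * (2 * n * (1 + η)) :=
        mul_le_mul_of_nonneg_right hN (by positivity)
    _ = (2 * n * τ) * (Shat * (m * (1 + η) + n * (1 - η)) * (1 + η)) := by ring
    _ ≤ ((1 - η) * ((1 + η) * Shat + n * τ)) *
        (Shat * (m * (1 + η) + n * (1 - η)) * (1 + η)) :=
        mul_le_mul_of_nonneg_right hD (by positivity)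
    _ = _ := by ring
end
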